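/- For every odd integer m ≥ 3, the flip graph of non-crossing perfect matchings G_m^M contains no 1-rainbow cycle. -/

import Mathlib

/-! Rainbow cycles in the flip graph of non-crossing perfect matchings on `2m`
points in convex position, labeled by the elements of `ZMod (2m)` in clockwise
cyclic order. -/

/-- `x` lies on the arc strictly between `a` and `b` (going in the direction of
increasing labels) in the cyclic order on `ZMod n`. -/
def StrictBtw (n : ℕ) (a x b : ZMod n) : Prop :=
  0 < (x - a).val ∧ (x - a).val < (b - a).val

/-- Two unordered pairs of points cross: all four points are distinct and
exactly one endpoint of the second pair lies on each of the two arcs strictly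
between the endpoints of the first pair. -/
def Crosses (n : ℕ) (e f : Sym2 (ZMod n)) : Prop :=
  ∃ a b c d : ZMod n, e = s(a, b) ∧ f = s(c, d) ∧
    a ≠ b ∧ a ≠ c ∧ a ≠ d ∧ b ≠ c ∧ b ≠ d ∧ c ≠ d ∧
    StrictBtw n a c b ∧ StrictBtw n b d a

/-- A possible matching edge on `2m` points: an unordered pair of points with
odd difference (so that an even number of points lies on either side). -/
def IsMEdge (m : ℕ) (e : Sym2 (ZMod (2 * m))) : Prop :=
  ∃ i j : ZMod (2 * m), e = s(i, j) ∧ Odd (j - i).val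

/-- A non-crossing perfect matching on the `2m` points: a set of matching
edges covering every point exactly once, no two of which cross. -/
def IsNCMatching (m : ℕ) (M : Finset (Sym2 (ZMod (2 * m)))) : Prop :=
  (∀ e ∈ M, IsMEdge m e) ∧
  (∀ p : ZMod (2 * m), ∃! e, e ∈ M ∧ p ∈ e) ∧
  (∀ e ∈ M, ∀ f ∈ M, ¬ Crosses (2 * m) e f)

/-- An `r`-rainbow cycle of length `L` in the flip graph `G_m^M` of
non-crossing perfect matchings, encoded as an `L`-periodic sequence `V` of
matchings: consecutive matchings differ in a flip (`|M \ M'| = 2`, i.e. two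
edges of `M` are replaced by the two other edges on the same four points, and
those two entering edges are the labels of the arc), no matching is visited
twice within a period, and every possible matching edge appears among the arc
labels (i.e. enters the matching) exactly `r` times per period. -/
def IsRainbowCycleM (m r L : ℕ) (V : ℕ → Finset (Sym2 (ZMod (2 * m)))) : Prop :=
  0 < L ∧
  (∀ i, V (i + L) = V i) ∧
  (∀ i < L, ∀ j < L, V i = V j → i = j) ∧
  (∀ i, IsNCMatching m (V i)) ∧
  (∀ i, (V i \ V (i + 1)).card = 2) ∧
  (∀ g : Sym2 (ZMod (2 * m)), IsMEdge m g →
    ((Finset.range L).filter (fun i => g ∈ V (i + 1) ∧ g ∉ V i)).card = r)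

/-- The residue class modulo `2` of a point among `2m` points. -/
def pointParity (m : ℕ) : ZMod (2 * m) →+* ZMod 2 :=
  ZMod.castHom (Dvd.intro m rfl) (ZMod 2)

theorem pointParity_eq_one_iff {m : ℕ} [NeZero m] (x : ZMod (2 * m)) :
    pointParity m x = 1 ↔ Odd x.val := by
  rw [← ZMod.natCast_eq_one_iff_odd, pointParity, ZMod.castHom_apply, ZMod.natCast_val]

theorem ZMod.two_eq_zero_or_one (x : ZMod 2) : x = 0 ∨ x = 1 := by
  revert x; decide

theorem isMEdge_mk_iff {m : ℕ} [NeZero m] (i j : ZMod (2 * m)) :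
    IsMEdge m s(i, j) ↔ pointParity m i ≠ pointParity m j := by
  have key : ∀ a b : ZMod (2 * m),
      Odd (b - a).val ↔ pointParity m a ≠ pointParity m b := by
    intro a b
    rw [← pointParity_eq_one_iff, map_sub]
    generalize pointParity m a = x
    generalize pointParity m b = y
    revert x y; decide
  constructor
  · rintro ⟨a, b, hab, ho⟩
    rw [key] at ho
    rcases Sym2.eq_iff.mp hab with ⟨rfl, rfl⟩ | ⟨rfl, rfl⟩
    · exact ho
    · exact ho.symm
  · exact fun h => ⟨i, j, rfl, (key i j).mpr h⟩

/-- Among `2m` points, exactly `m` have each given parity. -/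
theorem card_filter_pointParity {m : ℕ} [NeZero m] (c : ZMod 2) :
    (Finset.univ.filter (fun x => pointParity m x = c)).card = m := by
  have hshift : ∀ c : ZMod 2, (Finset.univ.filter (fun x => pointParity m x = c)).card =
      (Finset.univ.filter (fun x => pointParity m x = c + 1)).card := by
    intro c
    refine Finset.card_equiv (Equiv.addRight 1) fun x => ?_
    simp
  have htot : (Finset.univ.filter (fun x => pointParity m x = c)).card +
      (Finset.univ.filter (fun x => ¬ pointParity m x = c)).card = 2 * m := by
    rw [Finset.card_filter_add_card_filter_not, Finset.card_univ, ZMod.card]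
  have hne : ∀ x : ZMod (2 * m), ¬ pointParity m x = c ↔ pointParity m x = c + 1 := by
    intro x
    generalize pointParity m x = y
    clear htot
    revert y c; decide
  simp only [hne] at htot
  have := hshift c
  omega

open scoped Classical in
/-- There are `m²` possible matching edges. -/
theorem card_filter_isMEdge {m : ℕ} [NeZero m] :
    (Finset.univ.filter (IsMEdge m)).card = m ^ 2 := by
  have himage : Finset.univ.filter (IsMEdge m) =
      ((Finset.univ.filter (fun x => pointParity m x = 0)) ×ˢ
        (Finset.univ.filter (fun x => pointParity m x = 1))).image (fun p => s(p.1, p.2)) := by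
    ext e
    induction e using Sym2.ind with | _ i j
    simp only [Finset.mem_filter, Finset.mem_univ, true_and, isMEdge_mk_iff, Finset.mem_image,
      Finset.mem_product, Prod.exists]
    constructor
    · intro h
      rcases ZMod.two_eq_zero_or_one (pointParity m i) with hi | hi <;>
        rcases ZMod.two_eq_zero_or_one (pointParity m j) with hj | hj
      · exact absurd (hi.trans hj.symm) h
      · exact ⟨i, j, ⟨hi, hj⟩, rfl⟩
      · exact ⟨j, i, ⟨hj, hi⟩, Sym2.eq_swap⟩
      · exact absurd (hi.trans hj.symm) h
    · rintro ⟨a, b, ⟨ha, hb⟩, hab⟩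
      rcases Sym2.eq_iff.mp hab with ⟨rfl, rfl⟩ | ⟨rfl, rfl⟩ <;> simp [ha, hb]
  rw [himage, Finset.card_image_of_injOn, Finset.card_product, card_filter_pointParity,
    card_filter_pointParity, sq]
  rintro ⟨a, b⟩ hab ⟨c, d⟩ hcd h
  simp only [Finset.coe_product, Finset.coe_filter, Finset.mem_univ, true_and, Set.mem_prod,
    Set.mem_ofPred_eq] at hab hcd
  rcases Sym2.eq_iff.mp h with ⟨rfl, rfl⟩ | ⟨rfl, rfl⟩
  · rfl
  · exact absurd (hab.1.symm.trans hcd.2) zero_ne_one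

/-- A non-crossing perfect matching on `2m` points has `m` edges. -/
theorem IsNCMatching.card_eq {m : ℕ} [NeZero m] {M : Finset (Sym2 (ZMod (2 * m)))}
    (hM : IsNCMatching m M) : M.card = m := by
  have hcount := Finset.sum_card_bipartiteAbove_eq_sum_card_bipartiteBelow
    (s := M) (t := Finset.univ) (fun e p => p ∈ e)
  have hedge : ∀ e ∈ M, (Finset.univ.bipartiteAbove (fun e p => p ∈ e) e).card = 2 := by
    intro e he
    have hE := hM.1 e he
    induction e using Sym2.ind with | _ i j
    have hij : i ≠ j := by
      rintro rfl
      exact (isMEdge_mk_iff i i).mp hE rfl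
    refine Eq.trans ?_ (Finset.card_pair hij)
    congr 1
    ext x
    simp [Finset.mem_bipartiteAbove]
  have hpoint : ∀ p ∈ Finset.univ, (M.bipartiteBelow (fun e p => p ∈ e) p).card = 1 := by
    intro p _
    obtain ⟨e, he, huniq⟩ := hM.2.1 p
    refine Finset.card_eq_one.mpr ⟨e, Finset.ext fun f => ?_⟩
    rw [Finset.mem_bipartiteBelow, Finset.mem_singleton]
    exact ⟨huniq f, fun h => h ▸ he⟩
  rw [Finset.sum_congr rfl hedge, Finset.sum_congr rfl hpoint] at hcount
  simp only [Finset.sum_const, Finset.card_univ, ZMod.card, smul_eq_mul] at hcount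
  omega

/-- Counting arc labels in two ways: an `r`-rainbow cycle has length `r m² / 2`. -/
theorem IsRainbowCycleM.two_mul_length {m r L : ℕ} [NeZero m]
    {V : ℕ → Finset (Sym2 (ZMod (2 * m)))} (hV : IsRainbowCycleM m r L V) :
    2 * L = r * m ^ 2 := by
  classical
  obtain ⟨-, -, -, hmatch, hflip, hrain⟩ := hV
  have hcount := Finset.sum_card_bipartiteAbove_eq_sum_card_bipartiteBelow
    (s := Finset.range L) (t := Finset.univ.filter (IsMEdge m))
    (fun i g => g ∈ V (i + 1) ∧ g ∉ V i)
  have hleft : ∀ i ∈ Finset.range L, ((Finset.univ.filter (IsMEdge m)).bipartiteAbove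
      (fun i g => g ∈ V (i + 1) ∧ g ∉ V i) i).card = 2 := by
    intro i _
    refine Eq.trans ?_ ((Finset.card_sdiff_comm
      ((hmatch (i + 1)).card_eq.trans (hmatch i).card_eq.symm)).trans (hflip i))
    congr 1
    ext g
    simp only [Finset.mem_bipartiteAbove, Finset.mem_filter, Finset.mem_univ, true_and,
      Finset.mem_sdiff]
    exact ⟨fun h => h.2, fun h => ⟨(hmatch (i + 1)).1 g h.1, h⟩⟩
  have hright : ∀ g ∈ Finset.univ.filter (IsMEdge m), ((Finset.range L).bipartiteBelow
      (fun i g => g ∈ V (i + 1) ∧ g ∉ V i) g).card = r := by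
    intro g hg
    rw [← hrain g (Finset.mem_filter.mp hg).2]
    unfold Finset.bipartiteBelow
    congr
  rw [Finset.sum_congr rfl hleft, Finset.sum_congr rfl hright, Finset.sum_const, Finset.sum_const,
    Finset.card_range, card_filter_isMEdge, smul_eq_mul, smul_eq_mul] at hcount
  linarith

/-- For every odd `m ≥ 3`, the flip graph of non-crossing perfect matchings on
`2m` points contains no 1-rainbow cycle. -/
theorem matchings_no_one_rainbow_cycle_odd (m : ℕ) (hm : 3 ≤ m) (hodd : Odd m) :
    ¬ ∃ (L : ℕ) (V : ℕ → Finset (Sym2 (ZMod (2 * m)))),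
        IsRainbowCycleM m 1 L V := by
  rintro ⟨L, V, hV⟩
  have : NeZero m := ⟨by omega⟩
  have hlen := hV.two_mul_length
  rw [one_mul] at hlen
  exact Nat.not_even_iff_odd.mpr hodd.pow (hlen ▸ even_two_mul L)
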